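/- Let A, B, B', C be multiplicative characters of F_q, x ∈ F_q^*, t ∈ F_q^*, and y ∈ F_q^* with y ≠ 1. Then Σ_{λ,μ} binom(Aλ, λ)·binom(B̄B̄'C, B̄'Cλ)·binom(B̄'Cλ, Cλμ)·λ(x/t)·μ(−y) = (q−1)²·B'(−1)·C̄(y)·B̄'C(1−y)·₂F₁(A, B; B̄'C; x(1−y)/(ty)), where the double sum ranges over all multiplicative characters λ, μ of F_q. -/

import Mathlib

open Finset

namespace FFAppell

variable {F : Type*} [Field F] [Fintype F] [DecidableEq F]

/-- The multiplicative characters of a finite field form a finite type. -/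
noncomputable instance : Fintype (MulChar F ℂ) := Fintype.ofFinite _

/-- The Jacobi sum `J(χ, λ) = Σ_{u ∈ F} χ(u)·λ(1−u)`. -/
noncomputable def J (χ lam : MulChar F ℂ) : ℂ := ∑ u : F, χ u * lam (1 - u)

/-- The binomial coefficient `binom(A, B) := B(−1)·J(A, B̄)`. -/
noncomputable def binom (A B : MulChar F ℂ) : ℂ := B (-1) * J A B⁻¹

/-- `δ(χ) = 1` if `χ` is the trivial character, `0` otherwise. -/
noncomputable def δchar (χ : MulChar F ℂ) : ℂ := if χ = 1 then 1 else 0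

/-- `δ(x) = 1` if `x = 0`, `0` otherwise. -/
def δ (x : F) : ℂ := if x = 0 then 1 else 0

/-- The finite-field Gauss hypergeometric function
`₂F₁(A, B; C; x) := ε(x)·BC(−1)·Σ_{y ∈ F} B(y)·B̄C(1−y)·Ā(1−xy)`,
where `ε = 1` is the trivial character (with `ε 0 = 0`). -/
noncomputable def twoF1 (A B C : MulChar F ℂ) (x : F) : ℂ :=
  (1 : MulChar F ℂ) x * (B * C) (-1) *
    ∑ y : F, B y * (B⁻¹ * C) (1 - y) * A⁻¹ (1 - x * y)

/-- The finite-field `₃F₂` function: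
`₃F₂(A₀,A₁,A₂; B₁,B₂; x) := (1/(q−1))·Σ_χ binom(A₀χ,χ)·binom(A₁χ,B₁χ)·binom(A₂χ,B₂χ)·χ(x)`. -/
noncomputable def threeF2 (A₀ A₁ A₂ B₁ B₂ : MulChar F ℂ) (x : F) : ℂ :=
  (1 / ((Fintype.card F : ℂ) - 1)) *
    ∑ χ : MulChar F ℂ, binom (A₀ * χ) χ * binom (A₁ * χ) (B₁ * χ) *
      binom (A₂ * χ) (B₂ * χ) * χ x

/-- The finite-field Appell function `F₁(A; B, B'; C; x, y)`:
`ε(xy)·BB'(−1)·Σ_{u,v ∈ F} B(u)·B'(v)·(C·B̄·B̄')(1−u−v)·Ā(1−ux−vy)`. -/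
noncomputable def AppellF1 (A B B' C : MulChar F ℂ) (x y : F) : ℂ :=
  (1 : MulChar F ℂ) (x * y) * (B * B') (-1) *
    ∑ u : F, ∑ v : F,
      B u * B' v * (C * B⁻¹ * B'⁻¹) (1 - u - v) * A⁻¹ (1 - u * x - v * y)

/-- Orthogonality relation for the multiplicative characters of a finite field. -/
theorem sum_mulChar_apply (a : F) :
    ∑ χ : MulChar F ℂ, χ a = if a = 1 then (Fintype.card F : ℂ) - 1 else 0 := by
  split_ifs with ha
  · have hcard := MulChar.card_eq_card_units_of_hasEnoughRootsOfUnity F ℂ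
    rw [Nat.card_eq_fintype_card, Nat.card_eq_fintype_card, Fintype.card_units] at hcard
    simp [ha, hcard, Nat.cast_sub (Fintype.card_pos (α := F))]
  · obtain ⟨χ, hχ⟩ := MulChar.exists_apply_ne_one_of_hasEnoughRootsOfUnity F ℂ ha
    refine eq_zero_of_mul_eq_self_left hχ ?_
    simp only [Finset.mul_sum, ← MulChar.mul_apply]
    exact Fintype.sum_bijective _ (Group.mulLeft_bijective χ) _ _ fun _ ↦ rfl

omit [DecidableEq F] in
theorem binom_eq_sum (A χ : MulChar F ℂ) :
    binom A χ = ∑ u : F, A u * χ (-(1 - u)⁻¹) := by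
  simp only [binom, J, Finset.mul_sum]
  refine Finset.sum_congr rfl fun u _ ↦ ?_
  rw [MulChar.inv_apply', ← neg_one_mul (1 - u)⁻¹, map_mul]
  ring

/-- The binomial theorem over a finite field, away from `0`. -/
theorem sum_binom_mul_apply (A : MulChar F ℂ) {z : F} (hz : z ≠ 0) :
    ∑ χ : MulChar F ℂ, binom A χ * χ z = ((Fintype.card F : ℂ) - 1) * A (1 + z) := by
  have key : ∀ u : F, -(1 - u)⁻¹ * z = 1 ↔ u = 1 + z := by
    intro u
    by_cases hu : 1 - u = 0
    · have : u = 1 := by linear_combination -hu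
      simp [this, hz]
    · rw [neg_mul, neg_eq_iff_eq_neg, inv_mul_eq_iff_eq_mul₀ hu]
      constructor <;> intro h <;> linear_combination -h
  simp only [binom_eq_sum, Finset.sum_mul, mul_assoc, ← map_mul]
  rw [Finset.sum_comm]
  simp only [← Finset.mul_sum, sum_mulChar_apply, key]
  simp [mul_comm]

theorem sum_binom_mul_shift (A κ : MulChar F ℂ) {z : F} (hz : z ≠ 0) :
    ∑ μ : MulChar F ℂ, binom A (κ * μ) * μ z =
      ((Fintype.card F : ℂ) - 1) * κ⁻¹ z * A (1 + z) := by
  have : ∑ μ : MulChar F ℂ, binom A (κ * μ) * μ z =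
      ∑ χ : MulChar F ℂ, binom A χ * (κ⁻¹ * χ) z :=
    Fintype.sum_equiv (Equiv.mulLeft κ) _ _ fun μ ↦ by simp
  simp only [this, MulChar.mul_apply, mul_left_comm _ (κ⁻¹ z)]
  rw [← Finset.mul_sum, sum_binom_mul_apply A hz]
  ring

theorem sum_binom_mul_binom (A E D : MulChar F ℂ) {w : F} (hw : w ≠ 0) :
    ∑ χ : MulChar F ℂ, binom (A * χ) χ * binom E (D * χ) * χ w =
      ((Fintype.card F : ℂ) - 1) *
        ∑ s : F, E (1 - s⁻¹) * D (-s) * A⁻¹ (1 + w * s) := by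
  have hE : ∀ χ : MulChar F ℂ, binom E (D * χ) = ∑ s : F, E (1 - s⁻¹) * D (-s) * χ (-s) := by
    intro χ
    rw [binom_eq_sum]
    refine (Fintype.sum_equiv ((Equiv.inv F).trans (Equiv.subLeft 1)) _ _ fun s ↦ ?_).symm
    simp [mul_assoc]
  have hA : ∀ χ : MulChar F ℂ, binom (A * χ) χ = ∑ u : F, A u * χ (-(u * (1 - u)⁻¹)) := by
    intro χ
    rw [binom_eq_sum]
    refine Finset.sum_congr rfl fun u _ ↦ ?_
    rw [MulChar.mul_apply, mul_assoc, ← map_mul, mul_neg]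
  have hsum : ∀ s : F, s ≠ 0 →
      ∑ u : F, A u * ∑ χ : MulChar F ℂ, χ (-(u * (1 - u)⁻¹) * -s * w) =
        ((Fintype.card F : ℂ) - 1) * A⁻¹ (1 + w * s) := by
    intro s hs
    have key : ∀ u : F, -(u * (1 - u)⁻¹) * -s * w = 1 ↔ u * (1 + w * s) = 1 := by
      intro u
      by_cases hu : 1 - u = 0
      · have : u = 1 := by linear_combination -hu
        simp [this, hw, hs]
      · rw [show -(u * (1 - u)⁻¹) * -s * w = (1 - u)⁻¹ * (u * s * w) by ring,
          inv_mul_eq_iff_eq_mul₀ hu]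
        constructor <;> intro h <;> linear_combination h
    simp only [sum_mulChar_apply, key]
    by_cases h0 : 1 + w * s = 0
    · simp [h0, MulChar.map_zero]
    · simp only [mul_eq_one_iff_eq_inv₀ h0, MulChar.inv_apply']
      simp [mul_comm]
  simp only [hE, Finset.mul_sum, Finset.sum_mul]
  rw [Finset.sum_comm]
  refine Finset.sum_congr rfl fun s _ ↦ ?_
  by_cases hs : s = 0
  · simp [hs, MulChar.map_zero]
  · rw [mul_left_comm, ← hsum s hs]
    simp only [hA, Finset.mul_sum, Finset.sum_mul]
    rw [Finset.sum_comm]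
    refine Finset.sum_congr rfl fun u _ ↦ Finset.sum_congr rfl fun χ _ ↦ ?_
    simp only [map_mul]
    ring

omit [Fintype F] [DecidableEq F] in
theorem mulChar_neg_one_mul_self (χ : MulChar F ℂ) : χ (-1) * χ (-1) = 1 := by
  rw [← map_mul]; simp

theorem twoF1_eq_sum_binom (A B D : MulChar F ℂ) {z : F} (hz : z ≠ 0) :
    ∑ χ : MulChar F ℂ, binom (A * χ) χ * binom (B⁻¹ * D) (D * χ) * χ (-z) =
      ((Fintype.card F : ℂ) - 1) * D (-1) * twoF1 A B D z := by
  rw [sum_binom_mul_binom A _ D (neg_ne_zero.mpr hz), twoF1,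
    MulChar.one_apply (isUnit_iff_ne_zero.mpr hz), one_mul, mul_assoc]
  congr 1
  rw [← mul_assoc, Finset.mul_sum]
  refine Finset.sum_congr rfl fun s _ ↦ ?_
  by_cases hs : s = 0
  · simp [hs, MulChar.map_zero]
  have hD : D (s⁻¹) * D s = 1 := by rw [← map_mul, inv_mul_cancel₀ hs, map_one]
  have hinv : (1 : F) - s⁻¹ = -1 * (1 - s) * s⁻¹ := by field_simp; ring
  rw [hinv, ← neg_one_mul s, neg_mul z s, ← sub_eq_add_neg]
  simp only [map_mul, MulChar.mul_apply, MulChar.inv_apply', inv_inv, inv_neg, inv_one]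
  linear_combination (D (-1) * D (-1) * B (-1) * B (1 - s)⁻¹ * D (1 - s) * B s *
    A (1 - z * s)⁻¹) * hD

/-- Character double-sum identity (4.5) from the proof of the generating function. -/
theorem double_sum_identity_two (A B B' C : MulChar F ℂ) (x y t : F)
    (hx : x ≠ 0) (ht : t ≠ 0) (hy0 : y ≠ 0) (hy1 : y ≠ 1) :
    ∑ lam : MulChar F ℂ, ∑ mu : MulChar F ℂ,
        binom (A * lam) lam * binom (B⁻¹ * B'⁻¹ * C) (B'⁻¹ * C * lam) *
          binom (B'⁻¹ * C * lam) (C * lam * mu) * lam (x / t) * mu (-y) =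
      ((Fintype.card F : ℂ) - 1) ^ 2 * B' (-1) * C⁻¹ y * (B'⁻¹ * C) (1 - y) *
        twoF1 A B (B'⁻¹ * C) (x * (1 - y) / (t * y)) := by
  set D := B'⁻¹ * C with hDdef
  have hy : -y ≠ 0 := neg_ne_zero.mpr hy0
  have hy' : 1 - y ≠ 0 := sub_ne_zero.mpr hy1.symm
  have hz : x * (1 - y) / (t * y) ≠ 0 :=
    div_ne_zero (mul_ne_zero hx hy') (mul_ne_zero ht hy0)
  have inner : ∀ lam : MulChar F ℂ,
      ∑ mu : MulChar F ℂ, binom (A * lam) lam * binom (B⁻¹ * B'⁻¹ * C) (D * lam) *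
        binom (D * lam) (C * lam * mu) * lam (x / t) * mu (-y) =
      ((Fintype.card F : ℂ) - 1) * C⁻¹ (-y) * D (1 - y) *
        (binom (A * lam) lam * binom (B⁻¹ * D) (D * lam) *
          lam (-(x * (1 - y) / (t * y)))) := by
    intro lam
    have harg : -(x * (1 - y) / (t * y)) = x / t * (-y)⁻¹ * (1 - y) := by
      field_simp
    have hsum := sum_binom_mul_shift (D * lam) (C * lam) hy
    rw [← sub_eq_add_neg] at hsum
    simp only [mul_right_comm _ _ (lam (x / t))]
    simp only [mul_assoc _ (binom (D * lam) _) _]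
    rw [← Finset.mul_sum, hsum, harg, mul_assoc B⁻¹]
    simp only [mul_inv, map_mul, MulChar.mul_apply, MulChar.inv_apply']
    ring
  simp only [inner]
  rw [← Finset.mul_sum, twoF1_eq_sum_binom A B D hz]
  have hC : C⁻¹ (-y) * D (-1) = B' (-1) * C⁻¹ y := by
    rw [← neg_one_mul y, map_mul, hDdef]
    simp only [MulChar.mul_apply, MulChar.inv_apply', inv_neg, inv_one]
    linear_combination (B' (-1) * C y⁻¹) * mulChar_neg_one_mul_self C
  linear_combination (((Fintype.card F : ℂ) - 1) ^ 2 * D (1 - y) *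
    twoF1 A B D (x * (1 - y) / (t * y))) * hC

end FFAppell
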